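/- Let m ≥ 1, n = 2m, and let A₁,…,A_{2m} be pairwise commuting bounded self-adjoint operators on a complex Hilbert space H. Define the operator-valued function G(t) = t^{2m−1} ∫_{‖ω‖≤1, ω∈ℝ^{2m}} cos(tω₁A₁)·cos(tω₂A₂)⋯cos(tω_{2m}A_{2m}) · (1−‖ω‖²)^{−1/2} dω (a Bochner integral in the Banach space of bounded operators on H). Then G is m times differentiable in operator norm on (0,∞) and for every t > 0, cos(t·√(A₁²+⋯+A_{2m}²)) = (1/(2π)^m) · (D^{m−1}G)′(t). -/

import Mathlib

open MeasureTheory Real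

/-- The operator `(Df)(t) = f'(t)/t` for functions with values in a real normed space. -/
noncomputable def Dop {F : Type*} [NormedAddCommGroup F] [NormedSpace ℝ F]
    (f : ℝ → F) : ℝ → F := fun t => t⁻¹ • deriv f t

/-- `cos (s • T)` defined by its norm-convergent power series
`∑ (-1)^k s^(2k) T^(2k) / (2k)!`. -/
noncomputable def cosOp {H : Type*} [NormedAddCommGroup H] [InnerProductSpace ℂ H]
    (s : ℝ) (T : H →L[ℂ] H) : H →L[ℂ] H :=
  ∑' k : ℕ, (((-1:ℝ)^k * s^(2*k)) / (Nat.factorial (2*k) : ℝ)) • T^(2*k)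

theorem integral_homogeneous_mul_radial {E : Type*} [NormedAddCommGroup E] [NormedSpace ℝ E]
    [Nontrivial E] [FiniteDimensional ℝ E] [MeasurableSpace E] [BorelSpace E]
    (μ : Measure E) [μ.IsAddHaarMeasure] (f : E → ℝ) (d : ℕ)
    (hf : ∀ r : ℝ, 0 < r → ∀ x, f (r • x) = r ^ d * f x) (g : ℝ → ℝ) :
    ∫ x, f x * g ‖x‖ ∂μ = (∫ x : Metric.sphere (0 : E) 1, f x ∂μ.toSphere) *
      ∫ y in Set.Ioi (0 : ℝ), y ^ (Module.finrank ℝ E - 1 + d) * g y :=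
  calc
    ∫ x, f x * g ‖x‖ ∂μ = ∫ x : ({(0)}ᶜ : Set E), f x.1 * g ‖x.1‖ ∂(μ.comap (↑)) := by
      rw [integral_subtype_comap (measurableSet_singleton _).compl fun x ↦ f x * g (‖x‖),
        restrict_compl_singleton]
    _ = ∫ x, f x.1 * ((x.2 : ℝ) ^ d * g x.2)
          ∂μ.toSphere.prod (.volumeIoiPow (Module.finrank ℝ E - 1)) := by
      rw [← μ.measurePreserving_homeomorphUnitSphereProd.integral_comp
        (Homeomorph.measurableEmbedding _)
        (fun x : Metric.sphere (0 : E) 1 × Set.Ioi (0 : ℝ) => f x.1 * ((x.2 : ℝ) ^ d * g x.2))]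
      refine integral_congr_ae (.of_forall fun x => ?_)
      have hx : 0 < ‖x.1‖ := norm_pos_iff.2 x.2
      simp only [homeomorphUnitSphereProd_apply_snd_coe, homeomorphUnitSphereProd_apply_fst_coe]
      rw [hf _ (inv_pos.2 hx), inv_pow]
      field_simp
    _ = (∫ x : Metric.sphere (0 : E) 1, f x ∂μ.toSphere) *
          ∫ x : Set.Ioi (0 : ℝ), (x : ℝ) ^ d * g x ∂.volumeIoiPow (Module.finrank ℝ E - 1) :=
      integral_prod_mul (fun x : Metric.sphere (0 : E) 1 => f x)
        (fun x : Set.Ioi (0 : ℝ) => (x : ℝ) ^ d * g x)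
    _ = _ := by
      simp only [Measure.volumeIoiPow, ENNReal.ofReal]
      rw [integral_withDensity_eq_integral_smul,
        integral_subtype_comap measurableSet_Ioi fun a ↦
          Real.toNNReal (a ^ (Module.finrank ℝ E - 1)) • (a ^ d * g a),
        setIntegral_congr_fun measurableSet_Ioi fun x hx ↦ ?_]
      · rw [NNReal.smul_def, Real.coe_toNNReal _ (pow_nonneg hx.out.le _), smul_eq_mul, pow_add,
          mul_assoc]
      · exact (measurable_subtype_coe.pow_const _).real_toNNReal

theorem integral_Ioi_pow_mul_exp_neg_sq (q : ℕ) :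
    ∫ x in Set.Ioi (0 : ℝ), x ^ q * exp (-x ^ 2) = 1 / 2 * Gamma ((q + 1) / 2) := by
  have h := integral_rpow_mul_exp_neg_rpow (p := 2) (q := q) (by norm_num)
    (by have : (0 : ℝ) ≤ q := q.cast_nonneg
        linarith)
  rw [← h]
  refine setIntegral_congr_fun measurableSet_Ioi fun x _ => ?_
  simp only [rpow_natCast, rpow_ofNat]

theorem integral_even_pow_mul_exp_neg_sq (k : ℕ) :
    ∫ x : ℝ, x ^ (2 * k) * exp (-x ^ 2) = Gamma (k + 1 / 2) := by
  have h := integral_comp_abs (f := fun x : ℝ => x ^ (2 * k) * exp (-x ^ 2))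
  simp only [sq_abs, (even_two_mul k).pow_abs] at h
  rw [h, integral_Ioi_pow_mul_exp_neg_sq]
  push_cast
  ring_nf

theorem integral_monomial_mul_exp_neg_norm_sq {n : ℕ} (k : Fin n → ℕ) :
    ∫ x : EuclideanSpace ℝ (Fin n), (∏ i, x i ^ (2 * k i)) * exp (-‖x‖ ^ 2) =
      ∏ i, Gamma (k i + 1 / 2) := by
  have h := (EuclideanSpace.volume_preserving_symm_measurableEquiv_toLp (Fin n)).integral_comp
    (MeasurableEquiv.measurableEmbedding _)
    (fun y : Fin n → ℝ => ∏ i, (y i ^ (2 * k i) * exp (-y i ^ 2)))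
  rw [integral_fintype_prod_volume_eq_prod
    (fun i (y : ℝ) => y ^ (2 * k i) * exp (-y ^ 2))] at h
  simp only [integral_even_pow_mul_exp_neg_sq] at h
  rw [← h]
  refine integral_congr_ae (.of_forall fun x => ?_)
  simp only [EuclideanSpace.norm_sq_eq, Finset.prod_mul_distrib, ← Real.exp_sum,
    Finset.sum_neg_distrib, norm_eq_abs, sq_abs]
  rfl

/-- The Beta integral of the weight `(1 - x) ^ (-1/2)` on `[0, 1]`. -/
theorem integral_Ioc_pow_mul_one_sub_rpow (p : ℕ) :
    ∫ x in Set.Ioc (0 : ℝ) 1, x ^ p * (1 - x) ^ (-(1 : ℝ) / 2) =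
      Gamma (p + 1) * Gamma (1 / 2) / Gamma (p + 1 + 1 / 2) := by
  have h := ProbabilityTheory.beta_eq_betaIntegralReal (p + 1) (1 / 2) (by positivity)
    (by norm_num)
  rw [ProbabilityTheory.beta] at h
  have h2 : Complex.betaIntegral ((p + 1 : ℝ) : ℂ) ((1 / 2 : ℝ) : ℂ) =
      ((∫ x in (0 : ℝ)..1, x ^ p * (1 - x) ^ (-(1 : ℝ) / 2) : ℝ) : ℂ) := by
    rw [Complex.betaIntegral, ← intervalIntegral.integral_ofReal]
    refine intervalIntegral.integral_congr fun x hx => ?_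
    rw [Set.uIcc_of_le zero_le_one] at hx
    have e1 : ((p + 1 : ℝ) : ℂ) - 1 = (p : ℂ) := by push_cast; ring
    have e2 : ((1 / 2 : ℝ) : ℂ) - 1 = ((-(1 : ℝ) / 2 : ℝ) : ℂ) := by push_cast; ring
    simp only [e1, e2, Complex.cpow_natCast]
    rw [Complex.ofReal_mul, Complex.ofReal_cpow (by linarith [hx.2])]
    push_cast
    ring
  rw [h, h2, Complex.ofReal_re, intervalIntegral.integral_of_le zero_le_one]

theorem integral_Ioi_pow_mul_weight (p : ℕ) :
    ∫ y in Set.Ioi (0 : ℝ), y ^ (2 * p + 1) *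
      (Set.Iic (1 : ℝ)).indicator (fun y => (1 - y ^ 2) ^ (-(1 : ℝ) / 2)) y =
      1 / 2 * (Gamma (p + 1) * Gamma (1 / 2) / Gamma (p + 1 + 1 / 2)) := by
  rw [← integral_Ioc_pow_mul_one_sub_rpow]
  have h := integral_comp_rpow_Ioi_of_pos (p := 2) (g := (Set.Iic (1 : ℝ)).indicator
    (fun x : ℝ => x ^ p * (1 - x) ^ (-(1 : ℝ) / 2))) (by norm_num)
  rw [setIntegral_indicator measurableSet_Iic, Set.Ioi_inter_Iic] at h
  rw [← h, ← integral_const_mul]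
  refine setIntegral_congr_fun measurableSet_Ioi fun x hx => ?_
  have hx : (0 : ℝ) < x := hx
  have h1 : x ^ (2 : ℝ) ≤ 1 ↔ x ≤ 1 := by
    rw [rpow_ofNat]; exact pow_le_one_iff_of_nonneg hx.le (by norm_num)
  by_cases hx1 : x ≤ 1
  · rw [Set.indicator_of_mem (Set.mem_Iic.2 hx1), Set.indicator_of_mem (Set.mem_Iic.2 (h1.2 hx1))]
    norm_num
    ring
  · rw [Set.indicator_of_notMem (by simpa using hx1),
      Set.indicator_of_notMem (s := Set.Iic (1 : ℝ)) (fun h => hx1 (h1.1 h))]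
    simp

theorem integrable_weight {m : ℕ} (hm : 1 ≤ m) :
    IntegrableOn (fun ω : EuclideanSpace ℝ (Fin (2 * m)) => (1 - ‖ω‖ ^ 2) ^ (-(1 : ℝ) / 2))
      (Metric.closedBall 0 1) := by
  have : Nontrivial (EuclideanSpace ℝ (Fin (2 * m))) := by
    have : Nonempty (Fin (2 * m)) := ⟨⟨0, by omega⟩⟩
    infer_instance
  have h := integrable_fun_norm_addHaar (volume : Measure (EuclideanSpace ℝ (Fin (2 * m))))
    (f := (Set.Iic (1 : ℝ)).indicator (fun y => (1 - y ^ 2) ^ (-(1 : ℝ) / 2)))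
  rw [← integrable_indicator_iff Metric.isClosed_closedBall.measurableSet]
  refine (h.2 ?_).congr (.of_forall fun ω => ?_)
  rotate_left
  · simp [Set.indicator]
  · obtain ⟨q, rfl⟩ : ∃ q, m = q + 1 := ⟨m - 1, by omega⟩
    have : (2 * (q + 1) - 1) = 2 * q + 1 := by omega
    rw [finrank_euclideanSpace_fin, this]
    simp only [smul_eq_mul]
    by_contra hc
    have h0 := integral_undef hc
    rw [integral_Ioi_pow_mul_weight] at h0
    have : 0 < Gamma (q + 1 : ℝ) := Gamma_pos_of_pos (by positivity)
    have : 0 < Gamma (1 / 2 : ℝ) := Gamma_pos_of_pos (by positivity)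
    have : 0 < Gamma (q + 1 + 1 / 2 : ℝ) := Gamma_pos_of_pos (by positivity)
    have : 0 < 1 / 2 * (Gamma (q + 1 : ℝ) * Gamma (1 / 2) / Gamma (q + 1 + 1 / 2)) := by
      positivity
    linarith

/-- The even moments of the weight `(1 - ‖ω‖²) ^ (-1/2)` on the unit ball of `ℝ ^ (2m)`. -/
theorem integral_closedBall_monomial_mul_weight {m : ℕ} (hm : 1 ≤ m) (k : Fin (2 * m) → ℕ) :
    ∫ ω in Metric.closedBall (0 : EuclideanSpace ℝ (Fin (2 * m))) 1,
      (∏ i, ω i ^ (2 * k i)) * (1 - ‖ω‖ ^ 2) ^ (-(1 : ℝ) / 2) =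
      (∏ i, Gamma (k i + 1 / 2)) * √π / Gamma ((∑ i, k i : ℕ) + m + 1 / 2) := by
  have : Nontrivial (EuclideanSpace ℝ (Fin (2 * m))) := by
    have : Nonempty (Fin (2 * m)) := ⟨⟨0, by omega⟩⟩
    infer_instance
  obtain ⟨q, rfl⟩ : ∃ q, m = q + 1 := ⟨m - 1, by omega⟩
  have hf : ∀ r : ℝ, 0 < r → ∀ x : EuclideanSpace ℝ (Fin (2 * (q + 1))),
      ∏ i, (r • x) i ^ (2 * k i) = r ^ (2 * ∑ i, k i) * ∏ i, x i ^ (2 * k i) := by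
    intro r _ x
    simp [mul_pow, Finset.prod_mul_distrib, Finset.prod_pow_eq_pow_sum, Finset.mul_sum]
  have h1 := integral_homogeneous_mul_radial volume
    (fun x : EuclideanSpace ℝ (Fin (2 * (q + 1))) => ∏ i, x i ^ (2 * k i)) _ hf (fun y => exp (-y ^ 2))
  have h2 := integral_homogeneous_mul_radial volume
    (fun x : EuclideanSpace ℝ (Fin (2 * (q + 1))) => ∏ i, x i ^ (2 * k i)) _ hf
    (fun y => (Set.Iic (1 : ℝ)).indicator (fun y => (1 - y ^ 2) ^ (-(1 : ℝ) / 2)) y)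
  have hp : Module.finrank ℝ (EuclideanSpace ℝ (Fin (2 * (q + 1)))) - 1 + 2 * ∑ i, k i =
      2 * (q + ∑ i, k i) + 1 := by
    rw [finrank_euclideanSpace_fin]; omega
  rw [hp, integral_Ioi_pow_mul_exp_neg_sq, integral_monomial_mul_exp_neg_norm_sq] at h1
  rw [hp, integral_Ioi_pow_mul_weight] at h2
  rw [← integral_indicator Metric.isClosed_closedBall.measurableSet]
  calc _ = _ := by
        refine integral_congr_ae (.of_forall fun ω => ?_)
        simp [Set.indicator]
    _ = _ := h2
    _ = _ := by
        have e1 : ((2 * (q + ∑ i, k i) + 1 : ℕ) + 1 : ℝ) / 2 = (q + ∑ i, k i : ℕ) + 1 := by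
          push_cast; ring
        have e2 : ((∑ i, k i : ℕ) + (q + 1 : ℕ) + 1 / 2 : ℝ) = (q + ∑ i, k i : ℕ) + 1 + 1 / 2 := by
          push_cast; ring
        rw [h1, e1, e2, Gamma_one_half_eq]
        ring

theorem hasSum_prod_ofFn {R : Type*} [NormedRing R] [CompleteSpace R] :
    ∀ {n : ℕ} (f : Fin n → ℕ → R), (∀ i, Summable fun k => ‖f i k‖) →
      (Summable fun k : Fin n → ℕ => ‖(List.ofFn fun i => f i (k i)).prod‖) ∧
      HasSum (fun k : Fin n → ℕ => (List.ofFn fun i => f i (k i)).prod)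
        (List.ofFn fun i => ∑' k, f i k).prod
  | 0, f, _ => by
      refine ⟨(hasSum_fintype _).summable, ?_⟩
      simp
  | n + 1, f, hf => by
      obtain ⟨h1, h2⟩ := hasSum_prod_ofFn (fun i => f i.succ) fun i => hf i.succ
      have hs := (hf 0).mul_norm h1
      have hs' := summable_mul_of_summable_norm (hf 0) h1
      have ht := (hf 0).of_norm.hasSum.mul h2 hs'
      rw [← (Fin.consEquiv fun _ => ℕ).summable_iff, ← (Fin.consEquiv fun _ => ℕ).hasSum_iff]
      simp only [Function.comp_def, List.ofFn_succ, List.prod_cons, Fin.consEquiv_apply,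
        Fin.cons_zero, Fin.cons_succ]
      exact ⟨hs, ht⟩

theorem sum_piAntidiag_prod_ofFn_pow {R : Type*} [Ring R] [Algebra ℝ R] {n : ℕ} (B : Fin n → R)
    (hB : ∀ i j, Commute (B i) (B j)) (N : ℕ) :
    ∑ k ∈ Finset.piAntidiag Finset.univ N,
      (∏ i, ((k i).factorial : ℝ)⁻¹) • (List.ofFn fun i => B i ^ k i).prod =
      ((N.factorial : ℝ)⁻¹) • (∑ i, B i) ^ N := by
  rw [Finset.sum_pow_eq_sum_piAntidiag_of_commute _ _ (fun i _ j _ _ => hB i j), Finset.smul_sum]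
  refine Finset.sum_congr rfl fun k hk => ?_
  have hk : ∑ i, k i = N := by simpa using (Finset.mem_piAntidiag.1 hk).1
  have hl : (Finset.univ : Finset (Fin n)) = (List.finRange n).toFinset := by simp
  have hp : Finset.noncommProd Finset.univ (fun i => B i ^ k i)
      (fun i _ j _ _ => (hB i j).pow_pow _ _) = (List.ofFn fun i => B i ^ k i).prod := by
    rw [List.ofFn_eq_map, ← Finset.noncommProd_toFinset _ _ _ (List.nodup_finRange n)]
    · simp only [← hl]
    · exact fun i _ j _ _ => (hB i j).pow_pow _ _
  rw [hp, ← nsmul_eq_mul, ← Nat.cast_smul_eq_nsmul ℝ, smul_smul]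
  congr 1
  have := Nat.multinomial_spec Finset.univ k
  rw [hk] at this
  rw [← this]
  push_cast
  have h1 : ∏ i, ((k i).factorial : ℝ) ≠ 0 := Finset.prod_ne_zero_iff.2 fun i _ => by positivity
  have h2 : (Nat.multinomial Finset.univ k : ℝ) ≠ 0 := by
    exact_mod_cast (Nat.multinomial_pos _ _).ne'
  rw [Finset.prod_inv_distrib]
  field_simp

theorem HasSum.of_prod_ofFn_pow {R : Type*} [NormedRing R] [NormedAlgebra ℝ R] [CompleteSpace R]
    {n : ℕ} (B : Fin n → R) (hB : ∀ i j, Commute (B i) (B j)) (c : ℕ → ℝ) {a : R}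
    (h : HasSum (fun k : Fin n → ℕ => (c (∑ i, k i) * ∏ i, ((k i).factorial : ℝ)⁻¹) •
      (List.ofFn fun i => B i ^ k i).prod) a) :
    HasSum (fun N => (c N * (N.factorial : ℝ)⁻¹) • (∑ i, B i) ^ N) a := by
  have hfib := h.tsum_fiberwise (fun k => ∑ i, k i)
  refine (congrArg (HasSum · a) (funext fun N => ?_)).mpr hfib
  have hs : ((fun k : Fin n → ℕ => ∑ i, k i) ⁻¹' {N}) =
      (Finset.piAntidiag Finset.univ N : Finset (Fin n → ℕ)) := by
    ext k; simp [Finset.mem_piAntidiag]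
  rw [hs, Finset.tsum_subtype' (Finset.piAntidiag Finset.univ N)
    (fun k : Fin n → ℕ => (c (∑ i, k i) * ∏ i, ((k i).factorial : ℝ)⁻¹) •
      (List.ofFn fun i => B i ^ k i).prod), mul_smul, ← sum_piAntidiag_prod_ofFn_pow B hB,
    Finset.smul_sum]
  refine Finset.sum_congr rfl fun k hk => ?_
  have hk : ∑ i, k i = N := by simpa using (Finset.mem_piAntidiag.1 hk).1
  rw [hk, mul_smul]

theorem hasDerivAt_tsum_pow_smul {E : Type*} [NormedAddCommGroup E] [NormedSpace ℝ E]
    [CompleteSpace E] (v : ℕ → E) (hv : ∀ r : ℝ, Summable fun N => r ^ N * ‖v N‖) (q : ℕ) (t : ℝ) :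
    HasDerivAt (fun t : ℝ => ∑' N, t ^ (2 * N + q + 1) • v N)
      (∑' N, t ^ (2 * N + q) • ((2 * N + q + 1 : ℝ) • v N)) t := by
  set R : ℝ := |t| + 1 with hR
  have hR1 : 1 ≤ R := by have := abs_nonneg t; linarith
  have hu : Summable fun N : ℕ => R ^ q * (q + 3) * ((2 * R ^ 2) ^ N * ‖v N‖) :=
    (hv _).mul_left _
  refine hasDerivAt_tsum_of_isPreconnected (𝕜 := ℝ)
    (g := fun N t => t ^ (2 * N + q + 1) • v N)
    (g' := fun N t => t ^ (2 * N + q) • ((2 * N + q + 1 : ℝ) • v N)) (t := Metric.ball (0 : ℝ) R) (y₀ := 0) hu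
    Metric.isOpen_ball (convex_ball 0 R).isPreconnected ?_ ?_ ?_ ?_ ?_
  · intro N y _
    have := (hasDerivAt_pow (2 * N + q + 1) y).smul_const (v N)
    convert this using 1
    rw [smul_smul]
    push_cast
    rw [mul_comm]
  · intro N y hy
    have hy : |y| ≤ R := by simpa using (mem_ball_zero_iff.1 hy).le
    rw [norm_smul, norm_smul, norm_pow, norm_eq_abs, norm_eq_abs,
      abs_of_nonneg (by positivity : (0 : ℝ) ≤ 2 * N + q + 1)]
    have h1 : |y| ^ (2 * N + q) ≤ R ^ (2 * N + q) := pow_le_pow_left₀ (abs_nonneg _) hy _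
    have h2 : (2 * N + q + 1 : ℝ) ≤ (q + 3) * 2 ^ N := by
      have h3 : (N + 1 : ℝ) ≤ 2 ^ N := by exact_mod_cast Nat.lt_two_pow_self
      have h4 : (0 : ℝ) ≤ q := q.cast_nonneg
      have h5 : (0 : ℝ) ≤ N := N.cast_nonneg
      nlinarith
    calc _ ≤ R ^ (2 * N + q) * ((q + 3) * 2 ^ N * ‖v N‖) := by gcongr
      _ = _ := by rw [mul_pow, pow_add, pow_mul]; ring
  · simp; linarith
  · simp
  · simp [hR]

theorem summable_cosOp_bound (x : ℝ) :
    Summable fun k : ℕ => x ^ (2 * k) / (Nat.factorial (2 * k) : ℝ) :=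
  (Real.summable_pow_div_factorial x).comp_injective (i := fun k => 2 * k)
    (mul_right_injective₀ two_ne_zero)

theorem cfc_cos_mul_sqrt {H : Type*} [NormedAddCommGroup H] [InnerProductSpace ℂ H]
    [CompleteSpace H] {S : H →L[ℂ] H} (hS : 0 ≤ S) (t : ℝ) :
    HasSum (fun N : ℕ => ((-1) ^ N * t ^ (2 * N) / (Nat.factorial (2 * N) : ℝ)) • S ^ N)
      (cfc (fun x : ℝ => Real.cos (t * Real.sqrt x)) S) := by
  have hu := summable_cosOp_bound (|t| * √‖S‖)
  have hx0 : ∀ x ∈ spectrum ℝ S, 0 ≤ x := fun x hx => spectrum_nonneg_of_nonneg hS hx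
  have hb : ∀ (N : ℕ), ∀ x ∈ spectrum ℝ S,
      ‖(-1) ^ N * t ^ (2 * N) / (Nat.factorial (2 * N) : ℝ) * x ^ N‖ ≤
        (|t| * √‖S‖) ^ (2 * N) / (Nat.factorial (2 * N) : ℝ) := by
    intro N x hx
    have h1 : ‖x‖ ≤ ‖S‖ := (spectrum.norm_le_norm_mul_of_mem hx).trans
      (mul_le_of_le_one_right (norm_nonneg _) ContinuousLinearMap.norm_id_le)
    rw [norm_mul, norm_div, norm_mul, norm_pow, norm_pow, norm_pow, mul_pow, pow_mul √‖S‖,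
      sq_sqrt (norm_nonneg _)]
    simp only [norm_neg, norm_one, one_pow, one_mul, RCLike.norm_natCast, norm_eq_abs] at h1 ⊢
    rw [div_mul_eq_mul_div]
    gcongr
  have ht := tendsto_cfc_fun (a := S) (tendstoUniformlyOn_tsum_nat hu hb)
    (.of_forall fun _ =>
      (continuous_finsetSum _ fun _ _ => continuous_const.mul (continuous_pow _)).continuousOn)
  have hS' : IsSelfAdjoint S := IsSelfAdjoint.of_nonneg hS
  have hsum : Summable fun N : ℕ =>
      ((-1) ^ N * t ^ (2 * N) / (Nat.factorial (2 * N) : ℝ)) • S ^ N := by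
    refine .of_norm_bounded_eventually_nat hu ?_
    filter_upwards [Filter.eventually_gt_atTop 0] with N hN
    rw [norm_smul, norm_div, norm_mul, norm_pow, norm_pow, mul_pow, pow_mul √‖S‖,
      sq_sqrt (norm_nonneg _), norm_neg, norm_one, one_pow, one_mul, RCLike.norm_natCast,
      norm_eq_abs, div_mul_eq_mul_div]
    gcongr
    exact norm_pow_le' S hN
  have he : cfc (fun x : ℝ => Real.cos (t * √x)) S =
      cfc (fun x : ℝ => ∑' N : ℕ, (-1) ^ N * t ^ (2 * N) / (Nat.factorial (2 * N) : ℝ) * x ^ N)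
        S := by
    refine cfc_congr fun x hx => ?_
    rw [← (Real.hasSum_cos (t * √x)).tsum_eq]
    refine tsum_congr fun N => ?_
    rw [mul_pow, pow_mul √x, sq_sqrt (hx0 x hx)]
    ring
  rw [he, hsum.hasSum_iff_tendsto_nat]
  refine ht.congr fun n => ?_
  have hc := cfc_sum (fun (N : ℕ) (x : ℝ) => (-1) ^ N * t ^ (2 * N) / (Nat.factorial (2 * N) : ℝ) * x ^ N) S
    (Finset.range n) (fun _ _ => (continuous_const.mul (continuous_pow _)).continuousOn)
  rw [Finset.sum_fn] at hc
  rw [hc]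
  refine Finset.sum_congr rfl fun N _ => ?_
  rw [cfc_const_mul _ _ S, cfc_pow_id S N]

theorem Gamma_nat_add_nat_add_half (N m : ℕ) :
    Gamma (N + m + 1 / 2) * (4 ^ N * N.factorial * 2 ^ m) =
      (2 * N).factorial * √π * ∏ l ∈ Finset.range m, (2 * N + 2 * l + 1 : ℝ) := by
  induction m with
  | zero =>
    induction N with
    | zero => simpa using Gamma_one_half_eq
    | succ N ih =>
      have e : ((N + 1 : ℕ) : ℝ) + (0 : ℕ) + 1 / 2 = (N + 1 / 2) + 1 := by push_cast; ring
      rw [e, Gamma_add_one (by positivity), Nat.factorial_succ, pow_succ,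
        show 2 * (N + 1) = 2 * N + 1 + 1 by ring, Nat.factorial_succ, Nat.factorial_succ]
      simp only [Finset.range_zero, Finset.prod_empty, pow_zero, mul_one, Nat.cast_zero,
        add_zero] at ih ⊢
      push_cast
      linear_combination (N + 1 / 2 : ℝ) * 4 * (N + 1) * ih
  | succ m ih =>
    have e : (N : ℝ) + (m + 1 : ℕ) + 1 / 2 = (N + m + 1 / 2) + 1 := by push_cast; ring
    rw [e, Gamma_add_one (by positivity), pow_succ, Finset.prod_range_succ]
    linear_combination (2 * N + 2 * m + 1 : ℝ) * ih

theorem prod_ofFn_smul {R : Type*} [Ring R] [Algebra ℝ R] :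
    ∀ {n : ℕ} (c : Fin n → ℝ) (X : Fin n → R),
      (List.ofFn fun i => c i • X i).prod = (∏ i, c i) • (List.ofFn X).prod
  | 0, _, _ => by simp
  | n + 1, c, X => by
      simp only [List.ofFn_succ, List.prod_cons, Fin.prod_univ_succ, mul_smul]
      rw [prod_ofFn_smul (fun i => c i.succ), smul_mul_smul_comm, mul_smul]

theorem norm_prod_ofFn_le {R : Type*} [NormedRing R] (h1 : ‖(1 : R)‖ ≤ 1) :
    ∀ {n : ℕ} (f : Fin n → R) (g : Fin n → ℝ), (∀ i, ‖f i‖ ≤ g i) →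
      ‖(List.ofFn f).prod‖ ≤ ∏ i, g i
  | 0, _, _, _ => by simpa using h1
  | n + 1, f, g, h => by
      rw [List.ofFn_succ, List.prod_cons, Fin.prod_univ_succ]
      exact (norm_mul_le _ _).trans (mul_le_mul (h 0)
        (norm_prod_ofFn_le h1 _ _ fun i => h i.succ) (norm_nonneg _) ((norm_nonneg _).trans (h 0)))

theorem norm_clm_pow_le {H : Type*} [NormedAddCommGroup H] [InnerProductSpace ℂ H]
    (T : H →L[ℂ] H) : ∀ k : ℕ, ‖T ^ k‖ ≤ ‖T‖ ^ k
  | 0 => by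
      rw [pow_zero, pow_zero]
      exact ContinuousLinearMap.norm_id_le
  | k + 1 => norm_pow_le' T k.succ_pos

/-- The coefficients of the power series of the (normalised) iterates of `Dop` on the spherical
mean; `q = 0` gives `(2π)^m` times the cosine coefficients. -/
noncomputable def meanCoeff (m q N : ℕ) : ℝ :=
  (-1) ^ N * (2 * π) ^ m /
    ((2 * N).factorial * ∏ l ∈ Finset.range q, (2 * N + 2 * l + 1 : ℝ))

theorem mul_meanCoeff_succ (m q N : ℕ) :
    (2 * N + 2 * q + 1 : ℝ) * meanCoeff m (q + 1) N = meanCoeff m q N := by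
  have h : ∏ l ∈ Finset.range q, (2 * N + 2 * l + 1 : ℝ) ≠ 0 :=
    Finset.prod_ne_zero_iff.2 fun _ _ => by positivity
  rw [meanCoeff, meanCoeff, Finset.prod_range_succ]
  field_simp

theorem abs_meanCoeff_le (m q N : ℕ) :
    |meanCoeff m q N| ≤ (2 * π) ^ m / (2 * N).factorial := by
  have h : 1 ≤ ∏ l ∈ Finset.range q, (2 * N + 2 * l + 1 : ℝ) :=
    Finset.one_le_prod fun l _ => by
      have : (0 : ℝ) ≤ 2 * N + 2 * l := by positivity
      linarith
  have h0 : (0 : ℝ) < (2 * N).factorial := by positivity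
  rw [meanCoeff, abs_div, abs_mul, abs_pow, abs_neg, abs_one, one_pow, one_mul,
    abs_of_pos (by positivity : 0 < (2 * π) ^ m), abs_of_pos (by positivity)]
  gcongr
  nlinarith

theorem summable_pow_mul_norm_meanCoeff {H : Type*} [NormedAddCommGroup H]
    [InnerProductSpace ℂ H] (S : H →L[ℂ] H) (m q : ℕ) (r : ℝ) :
    Summable fun N => r ^ N * ‖meanCoeff m q N • S ^ N‖ := by
  refine .of_norm_bounded ((summable_cosOp_bound (√(|r| * ‖S‖))).mul_left ((2 * π) ^ m))
    fun N => ?_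
  rw [norm_mul, norm_norm, norm_pow, norm_smul, pow_mul, sq_sqrt (by positivity), mul_pow,
    norm_eq_abs, norm_eq_abs]
  calc |r| ^ N * (|meanCoeff m q N| * ‖S ^ N‖)
      ≤ |r| ^ N * ((2 * π) ^ m / (2 * N).factorial * ‖S‖ ^ N) := by
        gcongr
        · exact abs_meanCoeff_le m q N
        · exact norm_clm_pow_le S N
    _ = _ := by ring

theorem hasDerivAt_tsum_meanCoeff {H : Type*} [NormedAddCommGroup H] [InnerProductSpace ℂ H]
    [CompleteSpace H] (S : H →L[ℂ] H) (m : ℕ) (q : ℕ) (t : ℝ) :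
    HasDerivAt (fun t : ℝ => ∑' N, t ^ (2 * N + 2 * q + 1) • meanCoeff m (q + 1) N • S ^ N)
      (∑' N, t ^ (2 * N + 2 * q) • meanCoeff m q N • S ^ N) t := by
  have h := hasDerivAt_tsum_pow_smul _ (summable_pow_mul_norm_meanCoeff S m (q + 1)) (2 * q) t
  simpa only [smul_smul _ (meanCoeff m (q + 1) _), Nat.cast_mul, Nat.cast_ofNat,
    mul_meanCoeff_succ] using h

theorem Dop_tsum {H : Type*} [NormedAddCommGroup H] [InnerProductSpace ℂ H]
    [CompleteSpace H] (S : H →L[ℂ] H) (m : ℕ) (q : ℕ) :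
    Dop (fun t : ℝ => ∑' N, t ^ (2 * N + 2 * (q + 1) + 1) • meanCoeff m (q + 1 + 1) N • S ^ N) =
      fun t : ℝ => ∑' N, t ^ (2 * N + 2 * q + 1) • meanCoeff m (q + 1) N • S ^ N := by
  funext t
  rw [Dop, (hasDerivAt_tsum_meanCoeff S m (q + 1) t).deriv, ← tsum_const_smul'']
  refine tsum_congr fun N => ?_
  rw [smul_smul]
  congr 1
  rcases eq_or_ne t 0 with rfl | ht
  · simp
  · field_simp
    ring

theorem Dop_iterate_tsum {H : Type*} [NormedAddCommGroup H] [InnerProductSpace ℂ H]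
    [CompleteSpace H] (S : H →L[ℂ] H) (m : ℕ) (j q : ℕ) :
    Dop^[j] (fun t : ℝ => ∑' N, t ^ (2 * N + 2 * (q + j) + 1) • meanCoeff m (q + j + 1) N • S ^ N) =
      fun t : ℝ => ∑' N, t ^ (2 * N + 2 * q + 1) • meanCoeff m (q + 1) N • S ^ N := by
  induction j with
  | zero => rfl
  | succ j ih =>
    rw [Function.iterate_succ_apply, ← ih]
    congr 1
    exact Dop_tsum S m (q + j)

/-- The integral of one term of the multiple power series. -/
theorem integral_prod_cos_term {m : ℕ} (hm : 1 ≤ m) (t : ℝ) (k : Fin (2 * m) → ℕ) :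
    ∫ ω in Metric.closedBall (0 : EuclideanSpace ℝ (Fin (2 * m))) 1,
      (1 - ‖ω‖ ^ 2) ^ (-(1 : ℝ) / 2) *
        ∏ i, ((-1 : ℝ) ^ k i * (t * ω i) ^ (2 * k i) / (2 * k i).factorial) =
      (t ^ (2 * ∑ i, k i) * (meanCoeff m m (∑ i, k i) * (∑ i, k i).factorial)) *
        ∏ i, ((k i).factorial : ℝ)⁻¹ := by
  have h1 : ∀ ω : EuclideanSpace ℝ (Fin (2 * m)), (1 - ‖ω‖ ^ 2) ^ (-(1 : ℝ) / 2) *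
      ∏ i, ((-1 : ℝ) ^ k i * (t * ω i) ^ (2 * k i) / (2 * k i).factorial) =
      (∏ i, ((-1 : ℝ) ^ k i * t ^ (2 * k i) / (2 * k i).factorial)) *
        ((∏ i, ω i ^ (2 * k i)) * (1 - ‖ω‖ ^ 2) ^ (-(1 : ℝ) / 2)) := by
    intro ω
    rw [← mul_assoc, ← Finset.prod_mul_distrib, mul_comm]
    congr 1
    refine Finset.prod_congr rfl fun i _ => ?_
    rw [mul_pow]
    ring
  simp only [h1]
  rw [integral_const_mul, integral_closedBall_monomial_mul_weight hm, mul_div_assoc, ← mul_assoc,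
    ← Finset.prod_mul_distrib]
  have h2 : ∀ i, (-1 : ℝ) ^ k i * t ^ (2 * k i) / (2 * k i).factorial * Gamma (k i + 1 / 2) =
      ((-1) ^ k i * (t ^ 2) ^ k i * (1 / 4) ^ k i) * √π * ((k i).factorial : ℝ)⁻¹ := by
    intro i
    have h := Gamma_nat_add_nat_add_half (k i) 0
    simp only [Finset.range_zero, Finset.prod_empty, pow_zero, mul_one, Nat.cast_zero,
      add_zero] at h
    rw [pow_mul t, one_div (4 : ℝ), inv_pow]
    generalize Gamma (k i + 1 / 2 : ℝ) = g at *
    field_simp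
    linear_combination (t ^ 2) ^ k i * h
  have hs : √π ^ (2 * m) = π ^ m := by rw [pow_mul, sq_sqrt pi_pos.le]
  simp only [h2, ← mul_pow]
  rw [Finset.prod_mul_distrib, Finset.prod_mul_distrib, Finset.prod_pow_eq_pow_sum,
    Finset.prod_const, Finset.card_univ, Fintype.card_fin, hs, meanCoeff]
  generalize ∑ i, k i = N
  have h3 := Gamma_nat_add_nat_add_half N m
  have h4 : ∏ l ∈ Finset.range m, (2 * N + 2 * l + 1 : ℝ) ≠ 0 :=
    Finset.prod_ne_zero_iff.2 fun _ _ => by positivity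
  have h5 : Gamma (N + m + 1 / 2 : ℝ) ≠ 0 := (Gamma_pos_of_pos (by positivity)).ne'
  generalize ∏ i, ((k i).factorial : ℝ)⁻¹ = P
  generalize Gamma (N + m + 1 / 2 : ℝ) = g at *
  generalize ∏ l ∈ Finset.range m, (2 * N + 2 * l + 1 : ℝ) = Q at *
  have hg : g = (2 * N).factorial * √π * Q / (4 ^ N * N.factorial * 2 ^ m) := by
    field_simp
    linear_combination h3
  have hpi : √π ≠ 0 := by positivity
  rw [hg, mul_pow, mul_pow, one_div, inv_pow, ← pow_mul, mul_pow]
  field_simp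

theorem hasSum_integral_prod_cosOp {H : Type*} [NormedAddCommGroup H] [InnerProductSpace ℂ H]
    [CompleteSpace H] {m : ℕ} (hm : 1 ≤ m) (A : Fin (2 * m) → (H →L[ℂ] H))
    (hcomm : ∀ i j, Commute (A i) (A j)) (t : ℝ) :
    HasSum (fun N => t ^ (2 * N) • meanCoeff m m N • (∑ i, A i ^ 2) ^ N)
      (∫ ω in Metric.closedBall (0 : EuclideanSpace ℝ (Fin (2 * m))) 1,
        ((1 - ‖ω‖ ^ 2) ^ (-(1 : ℝ) / 2)) •
          (List.ofFn (fun i : Fin (2 * m) => cosOp (t * ω i) (A i))).prod) := by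
  set w : EuclideanSpace ℝ (Fin (2 * m)) → ℝ := fun ω => (1 - ‖ω‖ ^ 2) ^ (-(1 : ℝ) / 2)
  set K := Metric.closedBall (0 : EuclideanSpace ℝ (Fin (2 * m))) 1 with hK
  have hwi : IntegrableOn w K := integrable_weight hm
  have hw0 : ∀ ω ∈ K, 0 ≤ w ω := by
    intro ω hω
    have : ‖ω‖ ≤ 1 := by simpa [hK] using hω
    exact rpow_nonneg (by nlinarith [norm_nonneg ω]) _
  have hKm : MeasurableSet K := Metric.isClosed_closedBall.measurableSet
  let c : EuclideanSpace ℝ (Fin (2 * m)) → Fin (2 * m) → ℕ → ℝ := fun ω i k =>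
    (-1 : ℝ) ^ k * (t * ω i) ^ (2 * k) / (2 * k).factorial
  let b : Fin (2 * m) → ℕ → ℝ := fun i k => (|t| * ‖A i‖) ^ (2 * k) / (2 * k).factorial
  have hcb : ∀ ω ∈ K, ∀ i k, ‖c ω i k • A i ^ (2 * k)‖ ≤ b i k := by
    intro ω hω i k
    have h1 : |ω i| ≤ 1 := (PiLp.norm_apply_le ω i).trans (by simpa [hK] using hω)
    have h2 : |t * ω i| ≤ |t| := by
      rw [abs_mul]; exact mul_le_of_le_one_right (abs_nonneg _) h1
    rw [norm_smul, norm_div, norm_mul, norm_pow, norm_pow, norm_neg, norm_one, one_pow, one_mul,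
      RCLike.norm_natCast, norm_eq_abs, div_mul_eq_mul_div]
    simp only [b, mul_pow]
    gcongr
    exact norm_clm_pow_le _ _
  have hb : ∀ i, Summable (b i) := fun i => summable_cosOp_bound _
  have hbn : ∀ i, Summable fun k => ‖b i k‖ := fun i => (hb i).norm
  have hbs : Summable fun k : Fin (2 * m) → ℕ => ∏ i, b i (k i) := by
    simpa only [List.prod_ofFn] using (hasSum_prod_ofFn b hbn).2.summable
  let F : (Fin (2 * m) → ℕ) → EuclideanSpace ℝ (Fin (2 * m)) → (H →L[ℂ] H) := fun k ω =>
    (w ω * ∏ i, c ω i (k i)) • (List.ofFn fun i => (A i ^ 2) ^ k i).prod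
  have hF : ∀ k ω, F k ω = w ω • (List.ofFn fun i => c ω i (k i) • A i ^ (2 * k i)).prod := by
    intro k ω
    simp only [F, prod_ofFn_smul, mul_smul, pow_mul]
  have hint : ∀ k : Fin (2 * m) → ℕ, IntegrableOn (fun ω => w ω * ∏ i, c ω i (k i)) K := by
    intro k
    refine hwi.mul_continuousOn (Continuous.continuousOn ?_) (isCompact_closedBall _ _)
    simp only [c]
    fun_prop
  have hFint : ∀ k, Integrable (F k) (volume.restrict K) := fun k => (hint k).smul_const _
  have hFb : ∀ k, ∀ ω ∈ K, ‖F k ω‖ ≤ w ω * ∏ i, b i (k i) := by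
    intro k ω hω
    rw [hF, norm_smul, norm_eq_abs, abs_of_nonneg (hw0 ω hω)]
    exact mul_le_mul_of_nonneg_left (norm_prod_ofFn_le ContinuousLinearMap.norm_id_le _ _
      fun i => hcb ω hω i (k i)) (hw0 ω hω)
  have hsum : Summable fun k => ∫ ω in K, ‖F k ω‖ := by
    refine .of_nonneg_of_le (fun k => integral_nonneg fun _ => norm_nonneg _) (fun k => ?_)
      (hbs.mul_left (∫ ω in K, w ω))
    rw [← integral_mul_const]
    exact setIntegral_mono_on (hFint k).norm (hwi.mul_const _) hKm (hFb k)
  have h := hasSum_integral_of_summable_integral_norm hFint hsum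
  have hlim : ∫ ω in K, ∑' k, F k ω = ∫ ω in K, w ω •
      (List.ofFn (fun i : Fin (2 * m) => cosOp (t * ω i) (A i))).prod := by
    refine setIntegral_congr_fun hKm fun ω hω => ?_
    simp only [hF]
    exact ((hasSum_prod_ofFn (fun i k => c ω i k • A i ^ (2 * k)) fun i =>
      .of_nonneg_of_le (fun _ => norm_nonneg _) (hcb ω hω i) (hb i)).2.const_smul (w ω)).tsum_eq
  rw [hlim] at h
  have hterm : ∀ k, ∫ ω in K, F k ω =
      ((t ^ (2 * ∑ i, k i) * (meanCoeff m m (∑ i, k i) * (∑ i, k i).factorial)) *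
        ∏ i, ((k i).factorial : ℝ)⁻¹) • (List.ofFn fun i => (A i ^ 2) ^ k i).prod := by
    intro k
    rw [integral_smul_const, ← integral_prod_cos_term hm]
  simp only [hterm] at h
  have h' := HasSum.of_prod_ofFn_pow (fun i => A i ^ 2) (fun i j => (hcomm i j).pow_pow 2 2)
    (fun N => t ^ (2 * N) * (meanCoeff m m N * N.factorial)) h
  refine (congrArg (HasSum · _) (funext fun N => ?_)).mpr h'
  rw [smul_smul]
  congr 1
  field_simp

theorem stmt3 {H : Type*} [NormedAddCommGroup H] [InnerProductSpace ℂ H] [CompleteSpace H]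
    (m : ℕ) (hm : 1 ≤ m) (A : Fin (2*m) → (H →L[ℂ] H))
    (hsa : ∀ i, IsSelfAdjoint (A i))
    (hcomm : ∀ i j, Commute (A i) (A j))
    (G : ℝ → (H →L[ℂ] H))
    (hG : ∀ t : ℝ, G t = t ^ (2*m-1) •
      ∫ ω in Metric.closedBall (0 : EuclideanSpace ℝ (Fin (2*m))) 1,
        ((1 - ‖ω‖^2) ^ (-(1:ℝ)/2)) •
          (List.ofFn (fun i : Fin (2*m) => cosOp (t * ω i) (A i))).prod) :
    (∀ k < m, ∀ t ∈ Set.Ioi (0:ℝ), DifferentiableAt ℝ (Dop^[k] G) t) ∧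
    ∀ t ∈ Set.Ioi (0:ℝ),
      cfc (fun x : ℝ => Real.cos (t * Real.sqrt x)) (∑ i, (A i)^2) =
        (1 / (2*π)^m) • deriv (Dop^[m-1] G) t := by
  have hG' : G = fun t : ℝ => ∑' N, t ^ (2 * N + 2 * (m - 1) + 1) •
      meanCoeff m (m - 1 + 1) N • (∑ i, A i ^ 2) ^ N := by
    funext t
    rw [hG, ← (hasSum_integral_prod_cosOp hm A hcomm t).tsum_eq, ← tsum_const_smul'']
    refine tsum_congr fun N => ?_
    rw [smul_smul, ← pow_add, Nat.sub_add_cancel hm]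
    congr 2
    omega
  have hD : ∀ j q, q + j = m - 1 → Dop^[j] G = fun t : ℝ => ∑' N, t ^ (2 * N + 2 * q + 1) •
      meanCoeff m (q + 1) N • (∑ i, A i ^ 2) ^ N := by
    intro j q h
    rw [hG', ← h]
    exact Dop_iterate_tsum _ m j q
  have hS : 0 ≤ ∑ i, A i ^ 2 := Finset.sum_nonneg fun i _ => by
    have := star_mul_self_nonneg (A i)
    rwa [(hsa i).star_eq, ← sq] at this
  refine ⟨fun k hk t _ => ?_, fun t _ => ?_⟩
  · obtain ⟨q, hq⟩ : ∃ q, q + k = m - 1 := ⟨m - 1 - k, by omega⟩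
    rw [hD k q hq]
    exact (hasDerivAt_tsum_meanCoeff (H := H) _ m q t).differentiableAt
  · rw [hD (m - 1) 0 (by omega), (hasDerivAt_tsum_meanCoeff (H := H) _ m 0 t).deriv,
      ← (cfc_cos_mul_sqrt hS t).tsum_eq, ← tsum_const_smul'']
    refine tsum_congr fun N => ?_
    rw [smul_smul, smul_smul]
    congr 1
    simp only [meanCoeff, Finset.range_zero, Finset.prod_empty, mul_one, mul_zero, add_zero]
    field_simp
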